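/- arXiv:2004.07020 — 2 statements merged into one kernel-verified Lean document; each statement's English description precedes it below -/
import Mathlib

section
/- Fix an integer r ≥ 1, a real number ε ∈ [0,1/2], and real numbers a, b, c with |c| + |a| + r|b| ≤ ε. For ρ > 0 and t ∈ ℝ define f(ρ+it, ρ) = −Σ_{l=1}^{r} Σ_{m=1}^{∞} Σ_{k=1}^{m} Log(1 − e^{−ρ(c+ak+mbl) − (ρ+it)m}) (principal branch; each argument of Log lies in the open right half plane since |e^{−ρ(c+ak+mbl)−(ρ+it)m}| < 1). Then Re f(ρ+it, ρ) − f(ρ, ρ) ≤ −r Σ_{m=1}^{∞} m e^{−ρ(1+ε)m} (1 − cos(mt)). -/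
open Filter Set Finset

/-- Every term of the power series of `Re Log (1 - w) - log (1 - |w|)` is nonnegative, so its linear
term is a lower bound. -/
theorem norm_sub_re_le_log_one_sub {w : ℂ} (hw : ‖w‖ < 1) :
    ‖w‖ - w.re ≤ (Complex.log (1 - w)).re - Real.log (1 - ‖w‖) := by
  have hre := Complex.hasSum_re (Complex.hasSum_taylorSeries_neg_log hw)
  have hnorm := Complex.hasSum_re
    (Complex.hasSum_taylorSeries_neg_log (z := ((‖w‖ : ℝ) : ℂ)) (by simpa using hw))
  have hlog : (Complex.log (1 - ((‖w‖ : ℝ) : ℂ))).re = Real.log (1 - ‖w‖) := by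
    rw [← Complex.ofReal_one, ← Complex.ofReal_sub, Complex.log_ofReal_re]
  have hle := le_hasSum (hnorm.sub hre) 1 fun n _ => by
    rw [sub_nonneg, ← Complex.ofReal_pow, Complex.div_natCast_re, Complex.div_natCast_re,
      Complex.ofReal_re, ← norm_pow]
    gcongr
    exact Complex.re_le_norm _
  simp only [Complex.neg_re, hlog] at hle
  norm_num at hle
  linarith

theorem norm_log_one_sub_le_of_norm_le {w : ℂ} {s : ℝ} (hw : ‖w‖ ≤ s) (hs : s < 1) :
    ‖Complex.log (1 - w)‖ ≤ ‖w‖ * (1 + (1 - s)⁻¹) := by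
  have h := Complex.norm_log_one_add_le (z := -w) (by rw [norm_neg]; linarith)
  rw [norm_neg, ← sub_eq_add_neg] at h
  have hinv : (1 - ‖w‖)⁻¹ ≤ (1 - s)⁻¹ := inv_anti₀ (by linarith) (by linarith)
  have h0 : 0 ≤ (1 - ‖w‖)⁻¹ := inv_nonneg.2 (by linarith)
  have hw0 := norm_nonneg w
  have hsq : ‖w‖ ^ 2 ≤ ‖w‖ := by nlinarith
  have h1 : ‖w‖ ^ 2 * (1 - ‖w‖)⁻¹ ≤ ‖w‖ * (1 - s)⁻¹ := by gcongr
  have h2 : 0 ≤ ‖w‖ ^ 2 * (1 - ‖w‖)⁻¹ := by positivity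
  linarith

/-- A double series of logarithms whose inner sums have `m + 1` terms converges when the arguments
decay geometrically. -/
theorem summable_sum_log_one_sub {w : ℕ → ℕ → ℂ} {s : ℝ} (hs0 : 0 ≤ s) (hs : s < 1)
    (hw : ∀ m, ∀ k ∈ Finset.Icc 1 (m + 1), ‖w m k‖ ≤ s ^ (m + 1)) :
    Summable fun m : ℕ => ∑ k ∈ Finset.Icc 1 (m + 1), Complex.log (1 - w m k) := by
  have hgeom : Summable fun m : ℕ => ((m + 1 : ℕ) : ℝ) * s ^ (m + 1) := by
    have h := summable_pow_mul_geometric_of_norm_lt_one 1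
      (show ‖s‖ < 1 by rwa [Real.norm_of_nonneg hs0])
    simp only [pow_one] at h
    exact (summable_nat_add_iff 1).2 h
  refine Summable.of_norm_bounded (hgeom.mul_right (1 + (1 - s)⁻¹)) fun m => ?_
  have h0 : 0 ≤ (1 - s)⁻¹ := inv_nonneg.2 (by linarith)
  calc ‖∑ k ∈ Finset.Icc 1 (m + 1), Complex.log (1 - w m k)‖
      ≤ ∑ k ∈ Finset.Icc 1 (m + 1), s ^ (m + 1) * (1 + (1 - s)⁻¹) := by
        refine norm_sum_le_of_le _ fun k hk => ?_
        have hsm : s ^ (m + 1) ≤ s := pow_le_of_le_one hs0 hs.le m.succ_ne_zero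
        refine (norm_log_one_sub_le_of_norm_le ((hw m k hk).trans hsm) hs).trans ?_
        gcongr
        exact hw m k hk
    _ = ((m + 1 : ℕ) : ℝ) * s ^ (m + 1) * (1 + (1 - s)⁻¹) := by
        simp [mul_assoc]

theorem abs_perturbation_le {a b c ε M k l r : ℝ} (habc : |c| + |a| + r * |b| ≤ ε) (hM : 1 ≤ M)
    (hk : 0 ≤ k) (hkM : k ≤ M) (hl : 0 ≤ l) (hlr : l ≤ r) :
    |c + a * k + M * b * l| ≤ ε * M := by
  calc |c + a * k + M * b * l| ≤ |c| + |a * k| + |M * b * l| := abs_add_three _ _ _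
    _ = |c| * 1 + |a| * k + M * (|b| * l) := by
        rw [abs_mul, abs_mul, abs_mul, abs_of_nonneg hk, abs_of_nonneg hl,
          abs_of_nonneg (zero_le_one.trans hM)]
        ring
    _ ≤ |c| * M + |a| * M + M * (|b| * r) := by gcongr
    _ = (|c| + |a| + r * |b|) * M := by ring
    _ ≤ ε * M := by gcongr

/- STATEMENT 10 (minor-arc estimate): fix r ≥ 1, ε ∈ [0,1/2], and a, b, c with
|c|+|a|+r|b| ≤ ε.  For ρ > 0 and t : ℝ let
f(ρ+it,ρ) = −Σ_{l=1}^{r} Σ_{m≥1} Σ_{k=1}^{m} Log(1 − e^{−ρ(c+ak+mbl)−(ρ+it)m})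
(principal branch).  Then
Re f(ρ+it,ρ) − f(ρ,ρ) ≤ −r Σ_{m≥1} m e^{−ρ(1+ε)m}(1 − cos(mt)),
where f(ρ,ρ) = −Σ_{l,m,k} log(1 − e^{−ρ(m+c+ak+mbl)}) is real.  The summation
index m is shifted so that `m : ℕ` corresponds to m+1 ≥ 1. -/
theorem minor_arc_estimate (r : ℕ) (hr : 1 ≤ r)
    (ε : ℝ) (hε : ε ∈ Set.Icc (0 : ℝ) (1 / 2))
    (a b c : ℝ) (habc : |c| + |a| + r * |b| ≤ ε)
    (ρ : ℝ) (hρ : 0 < ρ) (t : ℝ) :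
    (-∑ l ∈ Finset.Icc 1 r, ∑' m : ℕ, ∑ k ∈ Finset.Icc 1 (m + 1),
        Complex.log (1 - Complex.exp
          (-(ρ : ℂ) * ((c : ℂ) + (a : ℂ) * k + ((m : ℂ) + 1) * (b : ℂ) * l)
            - ((ρ : ℂ) + (t : ℂ) * Complex.I) * ((m : ℂ) + 1)))).re
      - (-∑ l ∈ Finset.Icc 1 r, ∑' m : ℕ, ∑ k ∈ Finset.Icc 1 (m + 1),
          Real.log (1 - Real.exp
            (-ρ * (((m : ℝ) + 1) + c + a * k + ((m : ℝ) + 1) * b * l))))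
    ≤ -(r : ℝ) * ∑' m : ℕ,
        ((m : ℝ) + 1) * Real.exp (-ρ * (1 + ε) * ((m : ℝ) + 1)) *
          (1 - Real.cos (((m : ℝ) + 1) * t)) := by
  obtain ⟨-, hε2⟩ := hε
  set w : ℕ → ℕ → ℕ → ℂ := fun l m k => Complex.exp
    (-(ρ : ℂ) * ((c : ℂ) + (a : ℂ) * k + ((m : ℂ) + 1) * (b : ℂ) * l)
      - ((ρ : ℂ) + (t : ℂ) * Complex.I) * ((m : ℂ) + 1)) with hw
  set q : ℕ → ℕ → ℕ → ℝ := fun l m k =>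
    Real.exp (-ρ * (((m : ℝ) + 1) + c + a * k + ((m : ℝ) + 1) * b * l)) with hq
  have hexp : ∀ l m k, w l m k =
      Complex.exp (((-ρ * (((m : ℝ) + 1) + c + a * k + ((m : ℝ) + 1) * b * l) : ℝ) : ℂ)
        + ((-(((m : ℝ) + 1) * t) : ℝ) : ℂ) * Complex.I) := fun l m k => by
    simp only [hw]
    push_cast
    congr 1
    ring
  have hnorm : ∀ l m k, ‖w l m k‖ = q l m k := fun l m k => by
    rw [hexp, Complex.norm_exp, Complex.add_re, Complex.re_ofReal_mul, Complex.ofReal_re,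
      Complex.I_re, mul_zero, add_zero]
  have hre : ∀ l m k, (w l m k).re = q l m k * Real.cos (((m : ℝ) + 1) * t) := fun l m k => by
    rw [hexp, Complex.exp_add, ← Complex.ofReal_exp, Complex.re_ofReal_mul,
      Complex.exp_ofReal_mul_I_re, Real.cos_neg]
  have hpert : ∀ l ∈ Finset.Icc 1 r, ∀ m : ℕ, ∀ k ∈ Finset.Icc 1 (m + 1),
      |c + a * k + ((m : ℝ) + 1) * b * l| ≤ ε * ((m : ℝ) + 1) := fun l hl m k hk => by
    rw [Finset.mem_Icc] at hl hk
    exact abs_perturbation_le habc (by simp) k.cast_nonneg (by exact_mod_cast hk.2)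
      l.cast_nonneg (by exact_mod_cast hl.2)
  set s : ℝ := Real.exp (-(ρ / 2)) with hs
  have hs1 : s < 1 := Real.exp_lt_one_iff.2 (by linarith)
  have hs0 : 0 ≤ s := (Real.exp_pos _).le
  have hqs : ∀ l ∈ Finset.Icc 1 r, ∀ m : ℕ, ∀ k ∈ Finset.Icc 1 (m + 1),
      q l m k ≤ s ^ (m + 1) := fun l hl m k hk => by
    have h := (abs_le.1 (hpert l hl m k hk)).1
    rw [hs, ← Real.exp_nat_mul]
    refine Real.exp_le_exp.2 ?_
    have hm : (0 : ℝ) ≤ (m : ℝ) + 1 := by positivity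
    have h' : ((m : ℝ) + 1) / 2 ≤ ((m : ℝ) + 1) + c + a * k + ((m : ℝ) + 1) * b * l := by
      nlinarith
    push_cast
    nlinarith
  have hterm : ∀ l ∈ Finset.Icc 1 r, ∀ m : ℕ, ∀ k ∈ Finset.Icc 1 (m + 1),
      Real.exp (-ρ * (1 + ε) * ((m : ℝ) + 1)) * (1 - Real.cos (((m : ℝ) + 1) * t)) ≤
        (Complex.log (1 - w l m k)).re - Real.log (1 - q l m k) := fun l hl m k hk => by
    have hlt : ‖w l m k‖ < 1 := by
      rw [hnorm]
      exact (hqs l hl m k hk).trans_lt (pow_lt_one₀ hs0 hs1 m.succ_ne_zero)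
    have h := norm_sub_re_le_log_one_sub hlt
    rw [hnorm, hre, ← mul_one_sub] at h
    refine le_trans ?_ h
    refine mul_le_mul_of_nonneg_right (Real.exp_le_exp.2 ?_) (sub_nonneg.2 (Real.cos_le_one _))
    have h' := (abs_le.1 (hpert l hl m k hk)).2
    nlinarith
  have hsumC : ∀ l ∈ Finset.Icc 1 r,
      Summable fun m : ℕ => ∑ k ∈ Finset.Icc 1 (m + 1), Complex.log (1 - w l m k) :=
    fun l hl => summable_sum_log_one_sub hs0 hs1 fun m k hk => (hnorm l m k).trans_le
      (hqs l hl m k hk)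
  have hsumR : ∀ l ∈ Finset.Icc 1 r,
      Summable fun m : ℕ => ∑ k ∈ Finset.Icc 1 (m + 1), Real.log (1 - q l m k) := fun l hl => by
    have h := summable_sum_log_one_sub (w := fun m k => ((q l m k : ℝ) : ℂ)) hs0 hs1
      fun m k hk => by
        rw [Complex.norm_real, Real.norm_of_nonneg (Real.exp_pos _).le]
        exact hqs l hl m k hk
    refine (Complex.hasSum_re h.hasSum).summable.congr fun m => ?_
    rw [Complex.re_sum]
    refine Finset.sum_congr rfl fun k _ => ?_
    rw [← Complex.ofReal_one, ← Complex.ofReal_sub, Complex.log_ofReal_re]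
  have hmain : ∀ l ∈ Finset.Icc 1 r,
      ∑' m : ℕ, ((m : ℝ) + 1) * Real.exp (-ρ * (1 + ε) * ((m : ℝ) + 1)) *
          (1 - Real.cos (((m : ℝ) + 1) * t)) ≤
        (∑' m : ℕ, ∑ k ∈ Finset.Icc 1 (m + 1), Complex.log (1 - w l m k)).re -
          ∑' m : ℕ, ∑ k ∈ Finset.Icc 1 (m + 1), Real.log (1 - q l m k) := fun l hl => by
    have hd := (Complex.hasSum_re (hsumC l hl).hasSum).sub (hsumR l hl).hasSum
    have hle : ∀ m : ℕ, ((m : ℝ) + 1) * Real.exp (-ρ * (1 + ε) * ((m : ℝ) + 1)) *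
          (1 - Real.cos (((m : ℝ) + 1) * t)) ≤
        (∑ k ∈ Finset.Icc 1 (m + 1), Complex.log (1 - w l m k)).re -
          ∑ k ∈ Finset.Icc 1 (m + 1), Real.log (1 - q l m k) := fun m => by
      rw [Complex.re_sum, ← Finset.sum_sub_distrib]
      refine le_trans (le_of_eq ?_) (Finset.sum_le_sum (hterm l hl m))
      simp [mul_assoc]
    have hnonneg : ∀ m : ℕ, 0 ≤ ((m : ℝ) + 1) * Real.exp (-ρ * (1 + ε) * ((m : ℝ) + 1)) *
        (1 - Real.cos (((m : ℝ) + 1) * t)) := fun m =>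
      mul_nonneg (by positivity) (sub_nonneg.2 (Real.cos_le_one _))
    exact hasSum_le hle (Summable.of_nonneg_of_le hnonneg hle hd.summable).hasSum hd
  have hfinal := Finset.sum_le_sum hmain
  rw [Finset.sum_const, Nat.card_Icc, Nat.add_sub_cancel, nsmul_eq_mul, Finset.sum_sub_distrib,
    ← Complex.re_sum] at hfinal
  rw [Complex.neg_re]
  linarith
end

section
/- Fix an integer r ≥ 1 and real numbers α, β, γ with (α,β) ≠ (0,0). As ρ → 0⁺ one has Σ_{l=1}^{r} Σ_{m=1}^{∞} Σ_{k=1}^{m} (γ + αk + mβl)² · e^{−ρm}/(1 − e^{−ρm})² ∼ r (2α² + 3(r+1)αβ + (r+1)(2r+1)β²) ζ(3) ρ^{−4}, i.e. the ratio of the two sides tends to 1. -/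
open Filter Set Finset

/-- Apéry's constant ζ(3). -/
noncomputable def zeta3 : ℝ := ∑' k : ℕ, 1 / ((k : ℝ) + 1) ^ 3

/-- The function `x ^ j * e⁻ˣ / (1 - e⁻ˣ) ^ j`. -/
noncomputable def boseKernel (j : ℕ) (x : ℝ) : ℝ :=
  x ^ j * Real.exp (-x) / (1 - Real.exp (-x)) ^ j

lemma one_sub_exp_neg_pos {x : ℝ} (hx : 0 < x) : 0 < 1 - Real.exp (-x) := by
  have : Real.exp (-x) < 1 := Real.exp_lt_one_iff.2 (by linarith)
  linarith

lemma boseKernel_nonneg (j : ℕ) {x : ℝ} (hx : 0 < x) : 0 ≤ boseKernel j x := by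
  have := one_sub_exp_neg_pos hx
  unfold boseKernel
  positivity

lemma boseKernel_le (k : ℕ) {x : ℝ} (hx : 0 < x) :
    boseKernel (k + 1) x ≤ ((k : ℝ) + 1) ^ (k + 1) := by
  have hd := one_sub_exp_neg_pos hx
  have hk : (0 : ℝ) < (k : ℝ) + 1 := by positivity
  have h₁ : x ≤ (1 + x) * (1 - Real.exp (-x)) := by
    have h := mul_le_mul_of_nonneg_right (Real.add_one_le_exp x) (Real.exp_pos (-x)).le
    rw [← Real.exp_add, add_neg_cancel, Real.exp_zero] at h
    linarith
  have h₂ : 1 + x ≤ (k + 1) * Real.exp (x / (k + 1)) := by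
    have h := mul_le_mul_of_nonneg_left (Real.add_one_le_exp (x / ((k : ℝ) + 1))) hk.le
    have e : ((k : ℝ) + 1) * (x / (k + 1) + 1) = x + (k + 1) := by field_simp
    have : (0 : ℝ) ≤ k := by positivity
    linarith
  have h₃ : (1 + x) ^ (k + 1) ≤ ((k : ℝ) + 1) ^ (k + 1) * Real.exp x := by
    refine (pow_le_pow_left₀ (by positivity) h₂ (k + 1)).trans_eq ?_
    rw [mul_pow, ← Real.exp_nat_mul]
    congr 2
    push_cast
    field_simp
  unfold boseKernel
  rw [div_le_iff₀ (by positivity)]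
  calc x ^ (k + 1) * Real.exp (-x)
      ≤ ((1 + x) * (1 - Real.exp (-x))) ^ (k + 1) * Real.exp (-x) := by gcongr
    _ = (1 + x) ^ (k + 1) * Real.exp (-x) * (1 - Real.exp (-x)) ^ (k + 1) := by
        rw [mul_pow]
        ring
    _ ≤ ((k : ℝ) + 1) ^ (k + 1) * Real.exp x * Real.exp (-x)
          * (1 - Real.exp (-x)) ^ (k + 1) := by gcongr
    _ = ((k : ℝ) + 1) ^ (k + 1) * (1 - Real.exp (-x)) ^ (k + 1) := by
        rw [mul_assoc (_ ^ _), ← Real.exp_add, add_neg_cancel, Real.exp_zero, mul_one]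

lemma tendsto_boseKernel (j : ℕ) :
    Tendsto (boseKernel j) (nhdsWithin 0 (Set.Ioi 0)) (nhds 1) := by
  have hder : HasDerivAt (fun x : ℝ => 1 - Real.exp (-x)) 1 0 := by
    simpa using ((hasDerivAt_id (0 : ℝ)).neg.exp).const_sub 1
  have hslope : Tendsto (fun x : ℝ => x⁻¹ * (1 - Real.exp (-x)))
      (nhdsWithin 0 (Set.Ioi 0)) (nhds 1) := by
    have h := hasDerivAt_iff_tendsto_slope_zero.1 hder
    simp only [zero_add, neg_zero, Real.exp_zero, sub_self, sub_zero, smul_eq_mul] at h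
    exact h.mono_left (nhdsWithin_mono _ fun x hx => ne_of_gt hx)
  have hexp : Tendsto (fun x : ℝ => Real.exp (-x)) (nhdsWithin 0 (Set.Ioi 0)) (nhds 1) := by
    have : Continuous fun x : ℝ => Real.exp (-x) := by fun_prop
    simpa using (this.tendsto 0).mono_left nhdsWithin_le_nhds
  have h := hexp.mul ((hslope.inv₀ one_ne_zero).pow j)
  simp only [inv_one, one_pow, mul_one] at h
  refine h.congr fun x => ?_
  unfold boseKernel
  rw [mul_inv, inv_inv, mul_pow, inv_pow]
  ring

lemma summable_one_div_succ_pow {k : ℕ} (hk : 2 ≤ k) :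
    Summable fun n : ℕ => 1 / ((n : ℝ) + 1) ^ k := by
  have h := (summable_nat_add_iff 1).2 (Real.summable_one_div_nat_pow.2 hk)
  simpa using h

lemma norm_boseKernel_div_le (k n : ℕ) {ρ : ℝ} (hρ : 0 < ρ) :
    ‖boseKernel (k + 1) (ρ * (n + 1)) / ((n : ℝ) + 1) ^ k‖
      ≤ ((k : ℝ) + 1) ^ (k + 1) * (1 / ((n : ℝ) + 1) ^ k) := by
  have hx : 0 < ρ * ((n : ℝ) + 1) := by positivity
  rw [Real.norm_of_nonneg (div_nonneg (boseKernel_nonneg _ hx) (by positivity)), mul_one_div]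
  gcongr
  exact boseKernel_le k hx

lemma tendsto_tsum_boseKernel {k : ℕ} (hk : 2 ≤ k) :
    Tendsto (fun ρ : ℝ => ∑' n : ℕ, boseKernel (k + 1) (ρ * (n + 1)) / ((n : ℝ) + 1) ^ k)
      (nhdsWithin 0 (Set.Ioi 0)) (nhds (∑' n : ℕ, 1 / ((n : ℝ) + 1) ^ k)) := by
  refine tendsto_tsum_of_dominated_convergence
    ((summable_one_div_succ_pow hk).mul_left (((k : ℝ) + 1) ^ (k + 1))) (fun n => ?_) ?_
  · refine ((tendsto_boseKernel (k + 1)).comp ?_).div_const _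
    refine tendsto_nhdsWithin_iff.2 ⟨?_, ?_⟩
    · have : Continuous fun ρ : ℝ => ρ * ((n : ℝ) + 1) := by fun_prop
      simpa using (this.tendsto 0).mono_left nhdsWithin_le_nhds
    · filter_upwards [self_mem_nhdsWithin] with ρ hρ
      have hρ' : (0 : ℝ) < ρ := hρ
      show 0 < ρ * ((n : ℝ) + 1)
      positivity
  · filter_upwards [self_mem_nhdsWithin] with ρ hρ n
    exact norm_boseKernel_div_le k n hρ

/-- The summand `e^{-ρ(m+1)} / (1 - e^{-ρ(m+1)})²`, weighted by a binomial coefficient. -/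
noncomputable def lambertTerm (k : ℕ) (ρ : ℝ) (m : ℕ) : ℝ :=
  ((m + k).choose k : ℝ) *
    (Real.exp (-ρ * ((m : ℝ) + 1)) / (1 - Real.exp (-ρ * ((m : ℝ) + 1))) ^ 2)

lemma hasSum_choose_mul_exp (k : ℕ) {x : ℝ} (hx : 0 < x) :
    HasSum (fun m : ℕ => ((m + k).choose k : ℝ) * Real.exp (-x * (m + 1)))
      (Real.exp (-x) / (1 - Real.exp (-x)) ^ (k + 1)) := by
  have hq : ‖Real.exp (-x)‖ < 1 := by
    rw [Real.norm_of_nonneg (Real.exp_pos _).le]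
    exact Real.exp_lt_one_iff.2 (by linarith)
  have h := (hasSum_choose_mul_geometric_of_norm_lt_one k hq).mul_left (Real.exp (-x))
  rw [mul_one_div] at h
  refine h.congr_fun fun m => ?_
  rw [← Real.exp_nat_mul, mul_left_comm, ← Real.exp_add]
  ring_nf

lemma hasSum_lambertTerm {k : ℕ} (hk : 2 ≤ k) {ρ : ℝ} (hρ : 0 < ρ) :
    HasSum (lambertTerm k ρ)
      ((∑' n : ℕ, boseKernel (k + 1) (ρ * (n + 1)) / ((n : ℝ) + 1) ^ k) / ρ ^ (k + 1)) := by
  let f : ℕ × ℕ → ℝ := fun p =>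
    ((p.1 : ℝ) + 1) * (((p.2 + k).choose k : ℝ) * Real.exp (-(ρ * (p.1 + 1)) * (p.2 + 1)))
  have hrow (n : ℕ) : HasSum (fun m => f (n, m))
      (boseKernel (k + 1) (ρ * (n + 1)) / ((n : ℝ) + 1) ^ k / ρ ^ (k + 1)) := by
    have hx : 0 < ρ * ((n : ℝ) + 1) := by positivity
    have hd := one_sub_exp_neg_pos hx
    have e : boseKernel (k + 1) (ρ * (n + 1)) / ((n : ℝ) + 1) ^ k / ρ ^ (k + 1) =
        (n + 1) * (Real.exp (-(ρ * (n + 1))) / (1 - Real.exp (-(ρ * (n + 1)))) ^ (k + 1)) := by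
      unfold boseKernel
      field_simp
      rw [mul_pow]
      ring
    rw [e]
    exact (hasSum_choose_mul_exp k hx).mul_left ((n : ℝ) + 1)
  have hcol (m : ℕ) : HasSum (fun n => f (n, m)) (lambertTerm k ρ m) := by
    have hx : 0 < ρ * ((m : ℝ) + 1) := by positivity
    have h := (hasSum_choose_mul_exp 1 hx).mul_left ((m + k).choose k : ℝ)
    rw [← neg_mul] at h
    refine h.congr_fun fun n => ?_
    simp only [f, Nat.choose_one_right]
    push_cast
    rw [mul_left_comm]
    ring_nf
  have hsum : Summable fun n : ℕ =>
      boseKernel (k + 1) (ρ * (n + 1)) / ((n : ℝ) + 1) ^ k :=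
    .of_norm_bounded ((summable_one_div_succ_pow hk).mul_left (((k : ℝ) + 1) ^ (k + 1)))
      fun n => norm_boseKernel_div_le k n hρ
  have hf : Summable f := by
    refine (summable_prod_of_nonneg fun p => ?_).2 ⟨fun n => (hrow n).summable, ?_⟩
    · simp only [f, Pi.zero_apply]
      positivity
    · simpa only [(hrow _).tsum_eq] using hsum.div_const _
  have htot : HasSum f
      ((∑' n : ℕ, boseKernel (k + 1) (ρ * (n + 1)) / ((n : ℝ) + 1) ^ k) / ρ ^ (k + 1)) := by
    have h := hf.hasSum
    rwa [(h.prod_fiberwise hrow).unique (hsum.hasSum.div_const _)] at h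
  exact ((Equiv.prodComm ℕ ℕ).hasSum_iff.2 htot).prod_fiberwise hcol

lemma tendsto_pow_mul_tsum_lambertTerm {k : ℕ} (hk : 2 ≤ k) :
    Tendsto (fun ρ : ℝ => ρ ^ (k + 1) * ∑' m, lambertTerm k ρ m)
      (nhdsWithin 0 (Set.Ioi 0)) (nhds (∑' n : ℕ, 1 / ((n : ℝ) + 1) ^ k)) := by
  refine (tendsto_tsum_boseKernel hk).congr' ?_
  filter_upwards [self_mem_nhdsWithin] with ρ hρ
  have hρ' : (0 : ℝ) < ρ := hρ
  rw [(hasSum_lambertTerm hk hρ).tsum_eq]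
  field_simp

lemma lambertTerm_nonneg (k : ℕ) (ρ : ℝ) (m : ℕ) : 0 ≤ lambertTerm k ρ m := by
  unfold lambertTerm
  positivity

lemma lambertTerm_one_le_two (ρ : ℝ) (m : ℕ) : lambertTerm 1 ρ m ≤ lambertTerm 2 ρ m := by
  unfold lambertTerm
  gcongr
  rw [Nat.choose_succ_succ' (m + 1) 1]
  exact Nat.le_add_right _ _

lemma summable_lambertTerm_one {ρ : ℝ} (hρ : 0 < ρ) : Summable (lambertTerm 1 ρ) :=
  .of_nonneg_of_le (lambertTerm_nonneg 1 ρ) (lambertTerm_one_le_two ρ)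
    (hasSum_lambertTerm le_rfl hρ).summable

lemma tendsto_pow_four_mul_tsum_lambertTerm_two :
    Tendsto (fun ρ : ℝ => ρ ^ 4 * ∑' m, lambertTerm 2 ρ m)
      (nhdsWithin 0 (Set.Ioi 0)) (nhds 0) := by
  have hid : Tendsto (fun ρ : ℝ => ρ) (nhdsWithin 0 (Set.Ioi 0)) (nhds 0) :=
    tendsto_id.mono_left nhdsWithin_le_nhds
  have h := hid.mul (tendsto_pow_mul_tsum_lambertTerm (le_refl 2))
  rw [zero_mul] at h
  exact h.congr fun ρ => by ring

lemma tendsto_pow_four_mul_tsum_lambertTerm_one :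
    Tendsto (fun ρ : ℝ => ρ ^ 4 * ∑' m, lambertTerm 1 ρ m)
      (nhdsWithin 0 (Set.Ioi 0)) (nhds 0) := by
  refine squeeze_zero' ?_ ?_ tendsto_pow_four_mul_tsum_lambertTerm_two
  · exact .of_forall fun ρ => mul_nonneg (by positivity) (tsum_nonneg (lambertTerm_nonneg 1 ρ))
  · filter_upwards [self_mem_nhdsWithin] with ρ hρ
    gcongr
    · exact summable_lambertTerm_one hρ
    · exact (hasSum_lambertTerm le_rfl hρ).summable
    · exact lambertTerm_one_le_two ρ _

lemma sum_Icc_sq_affine (a b : ℝ) (n : ℕ) :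
    ∑ k ∈ Finset.Icc 1 n, (a + b * k) ^ 2 =
      n * a ^ 2 + a * b * (n * (n + 1)) + b ^ 2 * (n * (n + 1) * (2 * n + 1) / 6) := by
  induction n with
  | zero => simp
  | succ n ih =>
    rw [Finset.sum_Icc_succ_top (by omega), ih]
    push_cast
    ring

lemma sum_Icc_sq_mul_eq_lambertTerm (α β γ l ρ : ℝ) (m : ℕ) :
    ∑ k ∈ Finset.Icc 1 (m + 1),
        (γ + α * k + ((m : ℝ) + 1) * β * l) ^ 2 * Real.exp (-ρ * ((m : ℝ) + 1)) /
          (1 - Real.exp (-ρ * ((m : ℝ) + 1))) ^ 2 =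
      (2 * α ^ 2 + 6 * α * β * l + 6 * β ^ 2 * l ^ 2) * lambertTerm 3 ρ m
        + (-α ^ 2 + 2 * α * γ + 4 * β * γ * l - 4 * α * β * l - 6 * β ^ 2 * l ^ 2)
          * lambertTerm 2 ρ m
        + (γ ^ 2 + β ^ 2 * l ^ 2 - 2 * β * γ * l) * lambertTerm 1 ρ m := by
  have h₂ : ((m + 2).choose 2 : ℝ) = (m + 1) * (m + 2) / 2 := by
    rw [Nat.cast_choose_two]
    push_cast
    ring
  have h₃ : ((m + 3).choose 3 : ℝ) = (m + 1) * (m + 2) * (m + 3) / 6 := by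
    have h := Nat.add_one_mul_choose_eq (m + 2) 2
    have h' : ((m : ℝ) + 2 + 1) * ((m + 2).choose 2 : ℝ) = ((m + 3).choose 3 : ℝ) * (2 + 1) := by
      exact_mod_cast h
    rw [h₂] at h'
    linarith
  have h := sum_Icc_sq_affine (γ + ((m : ℝ) + 1) * β * l) α (m + 1)
  push_cast at h
  simp only [mul_div_assoc]
  rw [← Finset.sum_mul, Finset.sum_congr rfl fun k _ => by rw [add_right_comm], h]
  simp only [lambertTerm, h₂, h₃, Nat.choose_one_right]
  push_cast
  ring

lemma sum_Icc_quadratic (α β : ℝ) (r : ℕ) :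
    ∑ l ∈ Finset.Icc 1 r, (2 * α ^ 2 + 6 * α * β * l + 6 * β ^ 2 * (l : ℝ) ^ 2) =
      r * (2 * α ^ 2 + 3 * (r + 1) * α * β + (r + 1) * (2 * r + 1) * β ^ 2) := by
  induction r with
  | zero => simp
  | succ n ih =>
    rw [Finset.sum_Icc_succ_top (by omega), ih]
    push_cast
    ring

lemma quadratic_pos {r : ℕ} (hr : 1 ≤ r) {α β : ℝ} (hαβ : (α, β) ≠ (0, 0)) :
    0 < 2 * α ^ 2 + 3 * ((r : ℝ) + 1) * α * β + (r + 1) * (2 * r + 1) * β ^ 2 := by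
  have hr' : (1 : ℝ) ≤ r := by exact_mod_cast hr
  have e : 2 * α ^ 2 + 3 * ((r : ℝ) + 1) * α * β + (r + 1) * (2 * r + 1) * β ^ 2 =
      2 * (α + 3 * (r + 1) / 4 * β) ^ 2 + (r + 1) * (7 * r - 1) / 8 * β ^ 2 := by ring
  rw [e]
  have hc : 0 < ((r : ℝ) + 1) * (7 * r - 1) / 8 := by
    have : 0 < 7 * (r : ℝ) - 1 := by linarith
    positivity
  rcases eq_or_ne β 0 with rfl | hβ
  · have hα : α ≠ 0 := fun h => hαβ (by rw [h])
    simp only [mul_zero, add_zero]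
    positivity
  · positivity

lemma zeta3_pos : 0 < zeta3 :=
  (summable_one_div_succ_pow (by norm_num : 2 ≤ 3)).tsum_pos
    (fun n => by positivity) 0 (by norm_num)

/- STATEMENT 13 (Equation (4.21)): for r ≥ 1 and (α,β) ≠ (0,0), as ρ → 0⁺,
Σ_{l=1}^{r} Σ_{m≥1} Σ_{k=1}^{m} (γ+αk+mβl)² e^{−ρm}/(1−e^{−ρm})²
  ∼ r(2α² + 3(r+1)αβ + (r+1)(2r+1)β²) ζ(3) ρ^{−4},
i.e. the ratio of the two sides tends to 1.  The summation index m is shifted so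
that `m : ℕ` corresponds to m+1 ≥ 1. -/
theorem gyy_asymptotics (r : ℕ) (hr : 1 ≤ r) (α β γ : ℝ) (hαβ : (α, β) ≠ (0, 0)) :
    Filter.Tendsto (fun ρ : ℝ =>
        (∑ l ∈ Finset.Icc 1 r, ∑' m : ℕ, ∑ k ∈ Finset.Icc 1 (m + 1),
            (γ + α * k + ((m : ℝ) + 1) * β * l) ^ 2 *
              Real.exp (-ρ * ((m : ℝ) + 1)) /
              (1 - Real.exp (-ρ * ((m : ℝ) + 1))) ^ 2)
          / ((r : ℝ) * (2 * α ^ 2 + 3 * (r + 1) * α * β + (r + 1) * (2 * r + 1) * β ^ 2)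
              * zeta3 * ρ ^ (-4 : ℤ)))
      (nhdsWithin 0 (Set.Ioi 0)) (nhds 1) := by
  have hr' : (1 : ℝ) ≤ r := by exact_mod_cast hr
  have hQ := quadratic_pos hr hαβ
  set Q := 2 * α ^ 2 + 3 * ((r : ℝ) + 1) * α * β + (r + 1) * (2 * r + 1) * β ^ 2 with hQ_def
  have hC : (r : ℝ) * Q * zeta3 ≠ 0 := by
    have := zeta3_pos
    positivity
  have h₃ : Tendsto (fun ρ : ℝ => ρ ^ 4 * ∑' m, lambertTerm 3 ρ m)
      (nhdsWithin 0 (Set.Ioi 0)) (nhds zeta3) :=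
    tendsto_pow_mul_tsum_lambertTerm (k := 3) (by norm_num)
  have hlim := (tendsto_finsetSum (Finset.Icc 1 r) fun (l : ℕ) _ =>
    ((h₃.const_mul (2 * α ^ 2 + 6 * α * β * l + 6 * β ^ 2 * (l : ℝ) ^ 2)).add
      (tendsto_pow_four_mul_tsum_lambertTerm_two.const_mul
        (-α ^ 2 + 2 * α * γ + 4 * β * γ * l - 4 * α * β * l - 6 * β ^ 2 * (l : ℝ) ^ 2))).add
      (tendsto_pow_four_mul_tsum_lambertTerm_one.const_mul
        (γ ^ 2 + β ^ 2 * (l : ℝ) ^ 2 - 2 * β * γ * l))).div_const (r * Q * zeta3)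
  simp only [mul_zero, add_zero] at hlim
  rw [← Finset.sum_mul, sum_Icc_quadratic, ← hQ_def, div_self hC] at hlim
  refine hlim.congr' ?_
  filter_upwards [self_mem_nhdsWithin] with ρ hρ
  have hρ' : (0 : ℝ) < ρ := hρ
  have s₃ := (hasSum_lambertTerm (k := 3) (by norm_num) hρ').summable
  have s₂ := (hasSum_lambertTerm (le_refl 2) hρ').summable
  have s₁ := summable_lambertTerm_one hρ'
  simp only [sum_Icc_sq_mul_eq_lambertTerm]
  simp only [((s₃.mul_left _).add (s₂.mul_left _)).tsum_add (s₁.mul_left _),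
    (s₃.mul_left _).tsum_add (s₂.mul_left _), tsum_mul_left]
  rw [zpow_neg, div_mul_eq_div_div _ _ (ρ ^ (4 : ℤ))⁻¹, div_inv_eq_mul, div_mul_eq_mul_div, Finset.sum_mul]
  congr 1
  refine Finset.sum_congr rfl fun l _ => ?_
  norm_cast
  ring
end
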